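/- arXiv:2105.05663 — 6 statements merged into one kernel-verified Lean document; each statement's English description precedes it below -/
import Mathlib

section
/- Let ε = 1 or ε = −1 and let ρ, λ, a₁, a₂, a₃ ∈ ℝ satisfy the system λ − 1 − ερa₁ = a₁(a₂+a₃), λ − 1 − ερa₂ = a₂(a₁+a₃), λ − 1 − ερa₃ = a₃(a₁+a₂). Then either a₁ = a₂ = a₃, or a₁ = a₂ = −ερ, or a₁ = a₃ = −ερ, or a₂ = a₃ = −ερ. In other words, the shape operator is either a multiple of the identity or has exactly two distinct principal curvatures, with the repeated one equal to −ερ. (Forward direction of Lemma 3.3.) -/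
/-- Forward direction of Lemma 3.3: the scalar Ricci-soliton system forces the
shape operator to be umbilical or to have exactly two distinct principal
curvatures, the repeated one equal to `-ερ`. -/
theorem soliton_system_principal_curvatures
    (ε ρ lam a₁ a₂ a₃ : ℝ) (hε : ε = 1 ∨ ε = -1)
    (h1 : lam - 1 - ε * ρ * a₁ = a₁ * (a₂ + a₃))
    (h2 : lam - 1 - ε * ρ * a₂ = a₂ * (a₁ + a₃))
    (h3 : lam - 1 - ε * ρ * a₃ = a₃ * (a₁ + a₂)) :
    (a₁ = a₂ ∧ a₂ = a₃)
      ∨ (a₁ = a₂ ∧ a₁ = -(ε * ρ))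
      ∨ (a₁ = a₃ ∧ a₁ = -(ε * ρ))
      ∨ (a₂ = a₃ ∧ a₂ = -(ε * ρ)) := by
  have h₁₂ : a₁ = a₂ ∨ a₃ = -(ε * ρ) := by
    rw [← sub_eq_zero, ← sub_eq_zero (a := a₃), ← mul_eq_zero]
    linear_combination h2 - h1
  have h₁₃ : a₁ = a₃ ∨ a₂ = -(ε * ρ) := by
    rw [← sub_eq_zero, ← sub_eq_zero (a := a₂), ← mul_eq_zero]
    linear_combination h3 - h1
  have h₂₃ : a₂ = a₃ ∨ a₁ = -(ε * ρ) := by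
    rw [← sub_eq_zero, ← sub_eq_zero (a := a₁), ← mul_eq_zero]
    linear_combination h3 - h2
  grind
end

section
/- Let ε = 1 or ε = −1 and let ρ, a₁, a₂, a₃ ∈ ℝ. There exists λ ∈ ℝ satisfying the system λ − 1 − ερa₁ = a₁(a₂+a₃), λ − 1 − ερa₂ = a₂(a₁+a₃), λ − 1 − ερa₃ = a₃(a₁+a₂) if and only if a₁ = a₂ = a₃, or a₁ = a₂ = −ερ, or a₁ = a₃ = −ερ, or a₂ = a₃ = −ερ. (This is the algebraic content of Lemma 3.3: a pseudo-Riemannian hypersurface of E⁴₁ with diagonalizable shape operator admits a Ricci soliton (M, g, xᵀ, λ) if and only if the shape operator is umbilical or has two distinct principal curvatures with the repeated one equal to −ερ.) -/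
/-- The algebraic content of Lemma 3.3: the scalar Ricci-soliton system has a
solution `λ` iff the shape operator is umbilical or has two distinct principal
curvatures with the repeated one equal to `-ερ`. -/
theorem soliton_system_solvable_iff
    (ε ρ a₁ a₂ a₃ : ℝ) (hε : ε = 1 ∨ ε = -1) :
    (∃ lam : ℝ,
        lam - 1 - ε * ρ * a₁ = a₁ * (a₂ + a₃)
          ∧ lam - 1 - ε * ρ * a₂ = a₂ * (a₁ + a₃)
          ∧ lam - 1 - ε * ρ * a₃ = a₃ * (a₁ + a₂))
      ↔ ((a₁ = a₂ ∧ a₂ = a₃)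
          ∨ (a₁ = a₂ ∧ a₁ = -(ε * ρ))
          ∨ (a₁ = a₃ ∧ a₁ = -(ε * ρ))
          ∨ (a₂ = a₃ ∧ a₂ = -(ε * ρ))) := by
  constructor
  · rintro ⟨lam, h₁, h₂, h₃⟩
    have h₁₂ : (a₁ - a₂) * (a₃ + ε * ρ) = 0 := by linear_combination h₂ - h₁
    have h₁₃ : (a₁ - a₃) * (a₂ + ε * ρ) = 0 := by linear_combination h₃ - h₁
    have h₂₃ : (a₂ - a₃) * (a₁ + ε * ρ) = 0 := by linear_combination h₃ - h₂
    simp only [mul_eq_zero, sub_eq_zero, add_eq_zero_iff_eq_neg] at h₁₂ h₁₃ h₂₃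
    grind
  · intro h
    refine ⟨1 + ε * ρ * a₁ + a₁ * (a₂ + a₃), by ring, ?_, ?_⟩ <;>
      rcases h with ⟨h, h'⟩ | ⟨h, h'⟩ | ⟨h, h'⟩ | ⟨h, h'⟩ <;> grind
end

section
/- Let b₁ ≠ 0 be real, let G = diag(−1, 1, 1), and let A be the 3×3 real matrix with rows (a₁, b₁, 0), (−b₁, a₁, 0), (0, 0, a₂), with H = (2a₁ + a₂)/3. Then there exist no ρ, λ ∈ ℝ such that 3H·(Aᵀ·G) − Aᵀ·G·A = (λ−1)·G − ρ·(Aᵀ·G). (Case a of Theorem 3.8: no Lorentzian hypersurface of E⁴₁ whose shape operator has a complex-conjugate pair of eigenvalues admits a Ricci soliton with potential field the tangential part of the position vector.) -/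
open Matrix

/-- Case a of Theorem 3.8: a Lorentzian hypersurface of `𝔼⁴₁` whose shape
operator has a complex-conjugate pair of eigenvalues admits no Ricci soliton
with potential field the tangential part of the position vector. -/
theorem no_soliton_complex_eigenvalues
    (a₁ a₂ b₁ H : ℝ) (hb₁ : b₁ ≠ 0)
    (G A : Matrix (Fin 3) (Fin 3) ℝ)
    (hG : G = !![-1, 0, 0; 0, 1, 0; 0, 0, 1])
    (hA : A = !![a₁, b₁, 0; -b₁, a₁, 0; 0, 0, a₂])
    (hH : H = (2 * a₁ + a₂) / 3) :
    ¬ ∃ ρ lam : ℝ,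
        (3 * H) • (Aᵀ * G) - Aᵀ * G * A = (lam - 1) • G - ρ • (Aᵀ * G) := by
  rintro ⟨ρ, lam, h⟩
  subst hG hA
  have h₀₀ := congrFun (congrFun h 0) 0
  have h₀₁ := congrFun (congrFun h 0) 1
  have h₂₂ := congrFun (congrFun h 2) 2
  simp [Matrix.mul_apply, Fin.sum_univ_three] at h₀₀ h₀₁ h₂₂
  have htrace : 3 * H + ρ = 2 * a₁ := mul_left_cancel₀ hb₁ (by linarith)
  have hsum : (a₂ - a₁) ^ 2 + b₁ ^ 2 = 0 := by
    linear_combination (a₂ - a₁) * htrace - h₀₀ - h₂₂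
  have : 0 < b₁ ^ 2 := by positivity
  nlinarith [sq_nonneg (a₂ - a₁)]
end

section
/- Let G_ps be the 3×3 real matrix with rows (0, −1, 0), (−1, 0, 0), (0, 0, 1), let a₁, a₂, ρ, λ ∈ ℝ, let A be the matrix with rows (a₁, 0, 0), (1, a₁, 0), (0, 0, a₂), and set H = (2a₁ + a₂)/3. Then the soliton equation 3H·(Aᵀ·G_ps) − Aᵀ·G_ps·A = (λ−1)·G_ps − ρ·(Aᵀ·G_ps) holds if and only if a₂ = a₁, ρ = −a₁, and λ = 1 + a₁². (This is the characterization in Theorem 3.8: a Lorentzian hypersurface of E⁴₁ with nondiagonalizable shape operator admits a Ricci soliton (M, g, xᵀ, λ) exactly when the shape operator has the single double-root form with equal diagonal entries.) -/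
open Matrix

/-- Characterization in Theorem 3.8: for a shape operator with a double real
eigenvalue with one-dimensional eigenspace, the Ricci-soliton equation holds
iff `a₂ = a₁`, `ρ = -a₁` and `λ = 1 + a₁²`. -/
theorem soliton_double_root_iff
    (a₁ a₂ ρ lam H : ℝ)
    (Gps A : Matrix (Fin 3) (Fin 3) ℝ)
    (hG : Gps = !![0, -1, 0; -1, 0, 0; 0, 0, 1])
    (hA : A = !![a₁, 0, 0; 1, a₁, 0; 0, 0, a₂])
    (hH : H = (2 * a₁ + a₂) / 3) :
    (3 * H) • (Aᵀ * Gps) - Aᵀ * Gps * A = (lam - 1) • Gps - ρ • (Aᵀ * Gps)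
      ↔ (a₂ = a₁ ∧ ρ = -a₁ ∧ lam = 1 + a₁ ^ 2) := by
  subst hG hA hH
  constructor
  · intro h
    have h00 := congrFun (congrFun h 0) 0
    have h01 := congrFun (congrFun h 0) 1
    have h22 := congrFun (congrFun h 2) 2
    simp [Matrix.mul_apply, Fin.sum_univ_three] at h00 h01 h22
    have hρ : ρ = -a₂ := by linarith
    subst hρ
    have hlam : lam = 1 + a₁ ^ 2 := by linear_combination h01
    subst hlam
    have hsq : (a₂ - a₁) ^ 2 = 0 := by linear_combination -h22
    have heq : a₂ = a₁ := sub_eq_zero.mp (pow_eq_zero_iff two_ne_zero |>.mp hsq)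
    exact ⟨heq, by rw [heq], rfl⟩
  · rintro ⟨rfl, rfl, rfl⟩
    ext i j
    fin_cases i <;> fin_cases j <;>
      simp [Matrix.mul_apply, Fin.sum_univ_three] <;> ring
end

section
/- Let G_ps be the 3×3 real matrix with rows (0, −1, 0), (−1, 0, 0), (0, 0, 1), let a₁, a₂, ρ, λ ∈ ℝ, let A be the matrix with rows (a₁, 0, 0), (1, a₁, 0), (0, 0, a₂), and set H = (2a₁ + a₂)/3. If the soliton equation 3H·(Aᵀ·G_ps) − Aᵀ·G_ps·A = (λ−1)·G_ps − ρ·(Aᵀ·G_ps) holds, then λ = 1 + a₁² ≥ 1; in particular λ > 0, so the Ricci soliton is shrinking. (Corollary 3.13: there exists only a shrinking Ricci soliton on a Lorentzian isoparametric hypersurface of E⁴₁ with nondiagonalizable shape operator whose minimal polynomial has a double real root.) -/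
open Matrix

/-- Corollary 3.13: any Ricci soliton on a Lorentzian hypersurface of `𝔼⁴₁`
whose shape operator has the double-real-root nondiagonalizable form is
shrinking, with `λ = 1 + a₁² ≥ 1 > 0`. -/
theorem soliton_double_root_shrinking
    (a₁ a₂ ρ lam H : ℝ)
    (Gps A : Matrix (Fin 3) (Fin 3) ℝ)
    (hG : Gps = !![0, -1, 0; -1, 0, 0; 0, 0, 1])
    (hA : A = !![a₁, 0, 0; 1, a₁, 0; 0, 0, a₂])
    (hH : H = (2 * a₁ + a₂) / 3)
    (hsol : (3 * H) • (Aᵀ * Gps) - Aᵀ * Gps * A = (lam - 1) • Gps - ρ • (Aᵀ * Gps)) :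
    lam = 1 + a₁ ^ 2 ∧ 1 ≤ lam ∧ 0 < lam := by
  subst hG hA hH
  have h₀₀ := congrFun₂ hsol 0 0
  have h₀₁ := congrFun₂ hsol 0 1
  simp [Matrix.mul_apply, Fin.sum_univ_three] at h₀₀ h₀₁
  have hlam : lam = 1 + a₁ ^ 2 := by linear_combination h₀₁ - a₁ * h₀₀
  exact ⟨hlam, by nlinarith [sq_nonneg a₁], by nlinarith [sq_nonneg a₁]⟩
end

section
/- Let G_ps be the 3×3 real matrix with rows (0, −1, 0), (−1, 0, 0), (0, 0, 1), let a₁, a₂, ρ ∈ ℝ, let A be the matrix with rows (a₁, 0, 0), (1, a₁, 0), (0, 0, a₂), and set H = (2a₁ + a₂)/3. If the soliton equation 3H·(Aᵀ·G_ps) − Aᵀ·G_ps·A = (λ−1)·G_ps − ρ·(Aᵀ·G_ps) holds with λ = 1, then a₁ = a₂ = 0 and the Ricci matrix 3H·(Aᵀ·G_ps) − Aᵀ·G_ps·A is the zero matrix. (Remark 3.14: when λ = 1 the hypersurface is Ricci-flat and the tangential part of the position vector is a conformal Killing field, so M is an open portion of a generalized cylinder of type I in E⁴₁.) -/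
open Matrix

/-- Remark 3.14: when the Ricci-soliton equation holds with `λ = 1` in the
double-root case, the hypersurface is Ricci-flat: `a₁ = a₂ = 0` and the Ricci
matrix vanishes. -/
theorem soliton_double_root_lambda_one
    (a₁ a₂ ρ H : ℝ)
    (Gps A : Matrix (Fin 3) (Fin 3) ℝ)
    (hG : Gps = !![0, -1, 0; -1, 0, 0; 0, 0, 1])
    (hA : A = !![a₁, 0, 0; 1, a₁, 0; 0, 0, a₂])
    (hH : H = (2 * a₁ + a₂) / 3)
    (hsol : (3 * H) • (Aᵀ * Gps) - Aᵀ * Gps * A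
        = ((1 : ℝ) - 1) • Gps - ρ • (Aᵀ * Gps)) :
    a₁ = 0 ∧ a₂ = 0 ∧ (3 * H) • (Aᵀ * Gps) - Aᵀ * Gps * A = 0 := by
  subst hG hA hH
  have h00 := congrFun (congrFun hsol 0) 0
  have h01 := congrFun (congrFun hsol 0) 1
  have h22 := congrFun (congrFun hsol 2) 2
  simp [Matrix.mul_apply, Fin.sum_univ_three] at h00 h01 h22
  have hρ : ρ = -a₂ := by linarith
  subst hρ
  have h₁ : a₁ = 0 := by
    have : a₁ ^ 2 = 0 := by linear_combination -h01
    exact pow_eq_zero_iff two_ne_zero |>.mp this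
  subst h₁
  have h₂ : a₂ = 0 := by
    have : a₂ ^ 2 = 0 := by linear_combination -h22
    exact pow_eq_zero_iff two_ne_zero |>.mp this
  subst h₂
  refine ⟨rfl, rfl, ?_⟩
  rw [hsol]
  simp
end
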